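/- Let D ≥ 𝒟 and 0 ≤ i < 𝒟, and assume the set Att_HC(i) is closed under the step relation of Algo_FHC(D) (every step from a configuration of Att_HC(i) leads to a configuration of Att_HC(i)). If γ ∈ Att_HC(i) and γ ↦ γ' is a step of Algo_FHC(D) in which the non-root vertex p executes a rule, then Pred_UB_d(p, i+1) holds in γ'. -/

import Mathlib

open SimpleGraph

/-- A configuration: a distance value `d` and a parent pointer `par` per vertex. -/
structure Config (V : Type*) where
  d : V → ℕ
  par : V → V

/-- `Min_d(p)`: the minimum of the `d`-values of the neighbors of `p`. -/
noncomputable def minD {V : Type*} (G : SimpleGraph V) (γ : Config V) (p : V) : ℕ :=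
  sInf (γ.d '' {q | G.Adj p q})

def dOk {V : Type*} (G : SimpleGraph V) (γ : Config V) (p : V) : Prop :=
  γ.d p = minD G γ p + 1

def parOk {V : Type*} (γ : Config V) (p : V) : Prop :=
  γ.d p = γ.d (γ.par p) + 1

/-- A valid configuration of `Algo_U`: `d r = 0` and parent pointers are neighbors. -/
def ValidU {V : Type*} (G : SimpleGraph V) (r : V) (γ : Config V) : Prop :=
  γ.d r = 0 ∧ ∀ p, p ≠ r → G.Adj p (γ.par p)

/-- A valid configuration of the bounded algorithms: non-root `d`-values in `{1,…,D}`. -/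
def ValidB {V : Type*} (G : SimpleGraph V) (r : V) (D : ℕ) (γ : Config V) : Prop :=
  γ.d r = 0 ∧ ∀ p, p ≠ r → G.Adj p (γ.par p) ∧ 1 ≤ γ.d p ∧ γ.d p ≤ D

/-- Vertex `p` executes rule `U1` or `U2` in the step from `γ` to `γ'`:
`U1 : ¬dOk(p) → update(p)`, `U2 : dOk(p) ∧ ¬parOk(p) → par_p ← bestParent(p)`. -/
def execU {V : Type*} (G : SimpleGraph V) (γ γ' : Config V) (p : V) : Prop :=
  (¬ dOk G γ p ∧ γ'.d p = minD G γ p + 1 ∧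
    G.Adj p (γ'.par p) ∧ γ.d (γ'.par p) = minD G γ p) ∨
  (dOk G γ p ∧ ¬ parOk γ p ∧ γ'.d p = γ.d p ∧
    G.Adj p (γ'.par p) ∧ γ.d (γ'.par p) = minD G γ p)

/-- Vertex `p` executes one of the rules `B1`, `B2`, `B3` of `Algo_B(D)`. -/
def execB {V : Type*} (G : SimpleGraph V) (D : ℕ) (γ γ' : Config V) (p : V) : Prop :=
  (minD G γ p < D ∧ ¬ dOk G γ p ∧ γ'.d p = minD G γ p + 1 ∧
    G.Adj p (γ'.par p) ∧ γ.d (γ'.par p) = minD G γ p) ∨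
  (minD G γ p < D ∧ dOk G γ p ∧ ¬ parOk γ p ∧ γ'.d p = γ.d p ∧
    G.Adj p (γ'.par p) ∧ γ.d (γ'.par p) = minD G γ p) ∨
  (minD G γ p = D ∧ γ.d p ≠ D ∧ γ'.d p = D ∧ γ'.par p = γ.par p)

/-- Vertex `p` executes rule `HC1` or `HC2` of `Algo_HC(D)`. -/
def execHC {V : Type*} (G : SimpleGraph V) (D : ℕ) (γ γ' : Config V) (p : V) : Prop :=
  (¬ parOk γ p ∧ γ.d (γ.par p) < D ∧ γ'.d p = γ.d (γ.par p) + 1 ∧ γ'.par p = γ.par p) ∨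
  (minD G γ p < γ.d (γ.par p) ∧ γ'.d p = minD G γ p + 1 ∧
    G.Adj p (γ'.par p) ∧ γ.d (γ'.par p) = minD G γ p)

/-- Vertex `p` executes rule `HC2`: `d_{par_p} > Min_d(p) → update(p)`. -/
def execHC2 {V : Type*} (G : SimpleGraph V) (γ γ' : Config V) (p : V) : Prop :=
  minD G γ p < γ.d (γ.par p) ∧ γ'.d p = minD G γ p + 1 ∧
    G.Adj p (γ'.par p) ∧ γ.d (γ'.par p) = minD G γ p

/-- Vertex `p` executes rule `FHC1` or `HC2` of `Algo_FHC(D)`. -/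
def execFHC {V : Type*} (G : SimpleGraph V) (D : ℕ) (γ γ' : Config V) (p : V) : Prop :=
  (¬ parOk γ p ∧ γ.d (γ.par p) < D ∧ γ.d (γ.par p) = minD G γ p ∧
    γ'.d p = γ.d (γ.par p) + 1 ∧ γ'.par p = γ.par p) ∨
  execHC2 G γ γ' p

/-- A step of a distributed unfair daemon: a nonempty set `S` of (non-root) vertices,
each executing one of its enabled rules (as described by `exec`), all other vertices
keeping their state. -/
def StepWith {V : Type*} (r : V) (exec : Config V → Config V → V → Prop)
    (γ γ' : Config V) (S : Set V) : Prop :=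
  S.Nonempty ∧ (∀ p ∈ S, p ≠ r ∧ exec γ γ' p) ∧
    ∀ p ∉ S, γ'.d p = γ.d p ∧ γ'.par p = γ.par p

def Step {V : Type*} (r : V) (exec : Config V → Config V → V → Prop)
    (γ γ' : Config V) : Prop :=
  ∃ S : Set V, StepWith r exec γ γ' S

/-- Guard of the rules of `Algo_U` at `p`. -/
def guardU {V : Type*} (G : SimpleGraph V) (γ : Config V) (p : V) : Prop :=
  ¬ dOk G γ p ∨ (dOk G γ p ∧ ¬ parOk γ p)

/-- Guard of the rules of `Algo_B(D)` at `p`. -/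
def guardB {V : Type*} (G : SimpleGraph V) (D : ℕ) (γ : Config V) (p : V) : Prop :=
  (minD G γ p < D ∧ ¬ dOk G γ p) ∨
  (minD G γ p < D ∧ dOk G γ p ∧ ¬ parOk γ p) ∨
  (minD G γ p = D ∧ γ.d p ≠ D)

/-- Guard of the rules of `Algo_HC(D)` at `p`. -/
def guardHC {V : Type*} (G : SimpleGraph V) (D : ℕ) (γ : Config V) (p : V) : Prop :=
  (¬ parOk γ p ∧ γ.d (γ.par p) < D) ∨ minD G γ p < γ.d (γ.par p)

/-- Guard of the rules of `Algo_FHC(D)` at `p`. -/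
def guardFHC {V : Type*} (G : SimpleGraph V) (D : ℕ) (γ : Config V) (p : V) : Prop :=
  (¬ parOk γ p ∧ γ.d (γ.par p) < D ∧ γ.d (γ.par p) = minD G γ p) ∨
  minD G γ p < γ.d (γ.par p)

/-- A vertex is enabled when it is not the root and one of its guards holds. -/
def Enabled {V : Type*} (r : V) (guard : Config V → V → Prop) (γ : Config V) (p : V) : Prop :=
  p ≠ r ∧ guard γ p

/-- A terminal configuration: no vertex is enabled. -/
def Terminal {V : Type*} (r : V) (guard : Config V → V → Prop) (γ : Config V) : Prop :=
  ∀ p, ¬ Enabled r guard γ p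

/-- An execution (padded by stuttering once a terminal configuration is reached, so
that maximality is automatic): `e i` is the `i`-th configuration and `M i` the set of
vertices selected by the daemon at step `i`. -/
def IsExec {V : Type*} (r : V) (valid : Config V → Prop)
    (exec : Config V → Config V → V → Prop) (guard : Config V → V → Prop)
    (e : ℕ → Config V) (M : ℕ → Set V) : Prop :=
  (∀ i, valid (e i)) ∧
    ∀ i, (Terminal r guard (e i) ∧ e (i + 1) = e i ∧ M i = ∅) ∨
      StepWith r exec (e i) (e (i + 1)) (M i)

/-- Every vertex enabled in `e s` executes a rule or becomes neutralized in some step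
`j` with `s ≤ j < t`. -/
def Covers {V : Type*} (r : V) (guard : Config V → V → Prop)
    (e : ℕ → Config V) (M : ℕ → Set V) (s t : ℕ) : Prop :=
  ∀ p, Enabled r guard (e s) p →
    ∃ j, s ≤ j ∧ j < t ∧
      (p ∈ M j ∨ (Enabled r guard (e j) p ∧ ¬ Enabled r guard (e (j + 1)) p))

/-- `t` is the end of the round of execution `(e, M)` starting at index `s`:
the prefix from `s` to `t` is the minimal one in which every vertex enabled at `e s`
executes a rule or is neutralized. -/
def RoundEnd {V : Type*} (r : V) (guard : Config V → V → Prop)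
    (e : ℕ → Config V) (M : ℕ → Set V) (s t : ℕ) : Prop :=
  s ≤ t ∧ Covers r guard e M s t ∧ ∀ u, s ≤ u → Covers r guard e M s u → t ≤ u

/-- `Pred_UB_d(p,i)`: if `dist(r,p) > i` then `d p > i`, or `d p = i` and some
neighbor `q` of `p` has `d q ≤ i+1`. -/
def PredUBd {V : Type*} (G : SimpleGraph V) (r : V) (γ : Config V) (p : V) (i : ℕ) : Prop :=
  i < G.dist r p →
    (i < γ.d p ∨ (γ.d p = i ∧ ∃ q, G.Adj p q ∧ γ.d q ≤ i + 1))

/-- `Pred_correct_d(p,i)`: if `dist(r,p) ≤ i` then `d p = dist(r,p)`. -/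
def PredCorrectd {V : Type*} (G : SimpleGraph V) (r : V) (γ : Config V) (p : V) (i : ℕ) : Prop :=
  G.dist r p ≤ i → γ.d p = G.dist r p

/-- `Att_HC(i)`: every vertex satisfies `Pred_correct_d(·,i)` and every non-root
vertex satisfies `Pred_UB_d(·,i)`. -/
def AttHC {V : Type*} (G : SimpleGraph V) (r : V) (i : ℕ) (γ : Config V) : Prop :=
  (∀ p, PredCorrectd G r γ p i) ∧ ∀ p, p ≠ r → PredUBd G r γ p i

theorem minD_le_of_adj {V : Type*} {G : SimpleGraph V} (γ : Config V) {p q : V}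
    (h : G.Adj p q) : minD G γ p ≤ γ.d q :=
  Nat.sInf_le ⟨q, h, rfl⟩

/-- Both rules of `Algo_FHC(D)` set `d p` to `Min_d(p) + 1`, and this minimum is attained. -/
theorem execFHC.d_eq_and_exists_adj {V : Type*} {G : SimpleGraph V} {D : ℕ} {γ γ' : Config V}
    {p : V} (h : execFHC G D γ γ' p) (hpar : G.Adj p (γ.par p)) :
    γ'.d p = minD G γ p + 1 ∧ ∃ q, G.Adj p q ∧ γ.d q = minD G γ p := by
  rcases h with ⟨-, -, hmin, hd, -⟩ | ⟨-, hd, hadj, hmin⟩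
  · exact ⟨hmin ▸ hd, _, hpar, hmin⟩
  · exact ⟨hd, _, hadj, hmin⟩

/-- Let `D ≥ 𝒟` and `0 ≤ i < 𝒟`, and assume `Att_HC(i)` is closed under the step
relation of `Algo_FHC(D)`. If `γ ∈ Att_HC(i)` and `γ ↦ γ'` is a step of `Algo_FHC(D)`
in which the non-root vertex `p` executes a rule, then `Pred_UB_d(p, i+1)` holds
in `γ'`. -/
theorem attHC_step_predUBd {V : Type*} [Fintype V]
    (G : SimpleGraph V) (hconn : G.Connected) (r : V) (D i : ℕ)
    (hD : G.diam ≤ D) (hi : i < G.diam)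
    (hclosed : ∀ γ γ' : Config V, ValidB G r D γ → AttHC G r i γ →
      Step r (execFHC G D) γ γ' → AttHC G r i γ')
    (γ γ' : Config V) (S : Set V) (hvalid : ValidB G r D γ) (hatt : AttHC G r i γ)
    (hstep : StepWith r (execFHC G D) γ γ' S) (p : V) (hp : p ∈ S) (hpr : p ≠ r) :
    PredUBd G r γ' p (i + 1) := by
  intro hdist
  obtain ⟨-, hexec, hstay⟩ := hstep
  have hval : ∀ v ∈ S, γ'.d v = minD G γ v + 1 ∧ ∃ q, G.Adj v q ∧ γ.d q = minD G γ v :=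
    fun v hv => (hexec v hv).2.d_eq_and_exists_adj (hvalid.2 v (hexec v hv).1).1
  obtain ⟨hd, q, hpq, hq⟩ := hval p hp
  have hqdist : i < G.dist r q := by
    have htri := hconn.dist_triangle (u := r) (v := q) (w := p)
    rw [dist_eq_one_iff_adj.mpr hpq.symm] at htri
    omega
  have hqr : q ≠ r := by
    rintro rfl
    simp at hqdist
  rcases hatt.2 q hqr hqdist with hlt | ⟨heq, s, hqs, hs⟩
  · left
    omega
  · refine Or.inr ⟨by omega, q, hpq, ?_⟩
    by_cases hqS : q ∈ S
    · have hmin := minD_le_of_adj γ hqs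
      have hdq := (hval q hqS).1
      omega
    · have hdq := (hstay q hqS).1
      omega
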